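/- arXiv:1912.00659 — 7 statements merged into one kernel-verified Lean document; each statement's English description precedes it below -/
import Mathlib

section
/- For all r1, e1 ∈ ℝ, the point (0, r1, e1) is an equilibrium of system (bue.k13), and the total derivative (Jacobian matrix) of the vector field of (bue.k13) at (0, r1, e1) has characteristic polynomial X²·(X − λ) with λ = 32·e1·(1−e1)·(1−r1)·(γ−e1); i.e., its eigenvalues are 0 (with multiplicity two) and λ. In particular, for 0 ≤ r1 < 1 and γ < e1 < 1 the unique nonzero eigenvalue λ is negative, so the plane of equilibria {f1 = 0} is attracting there. -/
open Polynomial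

/-- The vector field of system (bue.k13), the restriction of the blown-up chart-K1
system to the invariant plane `{ε1 = 0}`, in coordinates `x = (f1, r1, e1)`. -/
noncomputable def K13Field (γ : ℝ) (x : Fin 3 → ℝ) : Fin 3 → ℝ :=
  let f1 := x 0
  let r1 := x 1
  let e1 := x 2
  ![32*f1*e1*(1-e1)*(1-r1)*(1-r1*f1)*((γ-e1) - 2*f1*(2*r1*f1 - 1)),
    64*r1*f1*e1*(1-e1)*(1-r1)*(1-r1*f1)*(2*r1*f1 - 1),
    64*r1*f1*e1*(1-e1)*(1-r1)*(1-r1*f1)*(2*r1 - 1)]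

theorem K13_aux (F g : (Fin 3 → ℝ) → ℝ) (L : (Fin 3 → ℝ) →L[ℝ] ℝ) (p : Fin 3 → ℝ) (hp : p 0 = 0)
    (hg : DifferentiableAt ℝ g p) (hF : ∀ x, F x = x 0 * g x) (hL : ∀ v, L v = g p * v 0) :
    HasFDerivAt F L p := by
  have h0 : HasFDerivAt (fun x : Fin 3 → ℝ => x 0)
      (ContinuousLinearMap.proj (R := ℝ) (φ := fun _ : Fin 3 => ℝ) 0) p :=
    hasFDerivAt_apply 0 p
  have h1 := h0.mul hg.hasFDerivAt
  have e1 : F = (fun x : Fin 3 → ℝ => x 0) * g := funext hF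
  rw [e1]
  refine h1.congr_fderiv ?_
  refine ContinuousLinearMap.ext fun v => ?_
  rw [hL v]
  simp [hp]

/-- Every point `(0, r1, e1)` is an equilibrium of (bue.k13); the Jacobian there has
characteristic polynomial `X²·(X − λ)` with `λ = 32 e1 (1-e1)(1-r1)(γ-e1)`, i.e. the
eigenvalues 0 (twice) and λ; and λ < 0 for `0 ≤ r1 < 1`, `γ < e1 < 1`. -/
theorem K13Field_plane_equilibria (γ : ℝ) (hγ0 : 0 < γ) (hγ1 : γ < 1) (r1 e1 : ℝ) :
    K13Field γ ![0, r1, e1] = 0 ∧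
    (∃ A : Matrix (Fin 3) (Fin 3) ℝ,
      HasFDerivAt (K13Field γ) (LinearMap.toContinuousLinearMap A.mulVecLin) ![0, r1, e1] ∧
      A.charpoly = X^2 * (X - C (32*e1*(1-e1)*(1-r1)*(γ-e1)))) ∧
    (0 ≤ r1 → r1 < 1 → γ < e1 → e1 < 1 → 32*e1*(1-e1)*(1-r1)*(γ-e1) < 0) := by
  refine ⟨?_, ⟨!![32*e1*(1-e1)*(1-r1)*(γ-e1), 0, 0;
      -(64*r1*e1*(1-e1)*(1-r1)), 0, 0;
      64*r1*e1*(1-e1)*(1-r1)*(2*r1-1), 0, 0], ?_, ?_⟩, ?_⟩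
  · ext i
    fin_cases i <;> simp [K13Field]
  · rw [hasFDerivAt_pi']
    intro i
    fin_cases i
    · refine K13_aux _ (fun x => 32*x 2*(1-x 2)*(1-x 1)*(1-x 1*x 0)*((γ-x 2) - 2*x 0*(2*x 1*x 0 - 1))) _
        ![0, r1, e1] (by simp) (by fun_prop) (fun x => ?_) (fun v => ?_)
      · simp [K13Field]; ring
      · simp [Matrix.mulVec, dotProduct, Fin.sum_univ_three]
    · refine K13_aux _ (fun x => 64*x 1*x 2*(1-x 2)*(1-x 1)*(1-x 1*x 0)*(2*x 1*x 0 - 1)) _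
        ![0, r1, e1] (by simp) (by fun_prop) (fun x => ?_) (fun v => ?_)
      · simp [K13Field]; ring
      · simp [Matrix.mulVec, dotProduct, Fin.sum_univ_three]
    · refine K13_aux _ (fun x => 64*x 1*x 2*(1-x 2)*(1-x 1)*(1-x 1*x 0)*(2*x 1 - 1)) _
        ![0, r1, e1] (by simp) (by fun_prop) (fun x => ?_) (fun v => ?_)
      · simp [K13Field]; ring
      · simp [Matrix.mulVec, dotProduct, Fin.sum_univ_three]
  · rw [Matrix.charpoly, Matrix.det_fin_three]
    simp [Matrix.charmatrix_apply, -map_mul, -map_sub]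
    ring
  · intro h0 h1 h2 h3
    have : 0 < 32*e1*(1-e1)*(1-r1) := by
      have a : 0 < e1 := by linarith
      have b : 0 < 1 - e1 := by linarith
      have c : 0 < 1 - r1 := by linarith
      positivity
    exact mul_neg_of_pos_of_neg this (by linarith)
end

section
/- Fix γ and e1 with 0 < γ < e1 < 1. The point (f1, r1, e1) = ((e1−γ)/2, 0, e1) is an equilibrium of system (bue.k13), and the Jacobian matrix of the vector field of (bue.k13) at this point has characteristic polynomial X·(X − λ)·(X + λ) = X³ − λ²·X with λ = 32·e1·(1−e1)·(e1−γ) > 0; i.e., its eigenvalues are 0, λ and −λ. Hence the curve of equilibria M1^r = {f1 = (e1−γ)/2, r1 = 0} is of saddle type. -/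
open Polynomial

/-- For `0 < γ < e1 < 1`, the point `((e1-γ)/2, 0, e1)` is an equilibrium of (bue.k13)
whose Jacobian has characteristic polynomial `X³ − λ²·X = X·(X-λ)·(X+λ)` with
`λ = 32 e1 (1-e1)(e1-γ) > 0`: the curve of equilibria `M1^r` is of saddle type. -/
theorem K13Field_M1r_saddle (γ e1 : ℝ) (hγ0 : 0 < γ) (h1 : γ < e1) (h2 : e1 < 1) :
    K13Field γ ![(e1-γ)/2, 0, e1] = 0 ∧
    (∃ A : Matrix (Fin 3) (Fin 3) ℝ,
      HasFDerivAt (K13Field γ) (LinearMap.toContinuousLinearMap A.mulVecLin)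
        ![(e1-γ)/2, 0, e1] ∧
      A.charpoly = X^3 - C ((32*e1*(1-e1)*(e1-γ))^2) * X) ∧
    0 < 32*e1*(1-e1)*(e1-γ) := by
  refine ⟨?_, ⟨!![32*e1*(1-e1)*(e1-γ), -4*(32*e1*(1-e1))*((e1-γ)/2)^3, -(32*e1*(1-e1))*((e1-γ)/2);
      0, -(32*e1*(1-e1)*(e1-γ)), 0; 0, -(32*e1*(1-e1)*(e1-γ)), 0], ?_, ?_⟩, ?_⟩
  · ext i
    fin_cases i <;> simp [K13Field]
    right
    ring
  · set p : Fin 3 → ℝ := ![(e1-γ)/2, 0, e1] with hp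
    have p0 : p 0 = (e1-γ)/2 := rfl
    have p1 : p 1 = 0 := rfl
    have p2 : p 2 = e1 := rfl
    have h0 : HasFDerivAt (fun x : Fin 3 → ℝ => x 0)
      (ContinuousLinearMap.proj (R := ℝ) (φ := fun _ : Fin 3 => ℝ) 0) p := hasFDerivAt_apply 0 p
    have h1 : HasFDerivAt (fun x : Fin 3 → ℝ => x 1)
      (ContinuousLinearMap.proj (R := ℝ) (φ := fun _ : Fin 3 => ℝ) 1) p := hasFDerivAt_apply 1 p
    have h2 : HasFDerivAt (fun x : Fin 3 → ℝ => x 2)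
      (ContinuousLinearMap.proj (R := ℝ) (φ := fun _ : Fin 3 => ℝ) 2) p := hasFDerivAt_apply 2 p
    have hd := (((h1.const_mul 2).mul h0).sub_const 1)
    have hA := ((((h0.const_mul 32).mul h2).mul (h2.const_sub 1)).mul (h1.const_sub 1)).mul
      ((h1.mul h0).const_sub 1)
    have hB := (((((h1.const_mul 64).mul h0).mul h2).mul (h2.const_sub 1)).mul
      (h1.const_sub 1)).mul ((h1.mul h0).const_sub 1)
    have hF0 := hA.mul ((h2.const_sub γ).sub ((h0.const_mul 2).mul hd))
    have hF1 := hB.mul hd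
    have hF2 := hB.mul ((h1.const_mul 2).sub_const 1)
    rw [hasFDerivAt_pi']
    intro i
    fin_cases i
    · refine HasFDerivAt.congr_fderiv (f := fun x => K13Field γ x 0) hF0 ?_
      ext v
      simp [p0, p1, p2, Matrix.mulVec, dotProduct, Fin.sum_univ_three]
      ring
    · refine HasFDerivAt.congr_fderiv (f := fun x => K13Field γ x 1) hF1 ?_
      ext v
      simp [p0, p1, p2, Matrix.mulVec, dotProduct, Fin.sum_univ_three]
      ring
    · refine HasFDerivAt.congr_fderiv (f := fun x => K13Field γ x 2) hF2 ?_
      ext v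
      simp [p0, p1, p2, Matrix.mulVec, dotProduct, Fin.sum_univ_three]
      ring
  · rw [Matrix.charpoly, Matrix.det_fin_three]
    simp [Matrix.charmatrix_apply]
    ring
  · have a : 0 < e1 := hγ0.trans h1
    have b : 0 < 1 - e1 := sub_pos.2 h2
    have c : 0 < e1 - γ := sub_pos.2 h1
    positivity
end

section
/- Fix γ and e2 with 0 < γ < e2 < 1, and consider the layer problem (bue.k23) in the fast variables (f2, c2). The point (f2*, c2*) = (γ/(2·(e2−γ)), 0) is an equilibrium of the planar fast vector field, and the derivative (Jacobian matrix) of this vector field at (f2*, c2*) is the diagonal matrix diag(λ21, λ22) with λ21 = −16·e2·(1−e2)·(e2−γ) and λ22 = 32·e2²·(e2−1)/(e2−γ). Both λ21 < 0 and λ22 < 0; hence the critical manifold N2^0 = {(f2, c2, e2) : f2 = γ/(2·(e2−γ)), c2 = 0, e2 ∈ I2^0} is normally hyperbolic and fully attracting for e2 in any compact subset I2^0 of (γ, 1). -/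
/-- The planar fast vector field of the layer problem (bue.k23) in chart K2, for
fixed `e2`, in coordinates `x = (f2, c2)`. -/
noncomputable def K2LayerField (γ e2 : ℝ) (x : Fin 2 → ℝ) : Fin 2 → ℝ :=
  let f2 := x 0
  let c2 := x 1
  ![8*e2*(γ*(1+2*f2) - 2*f2*e2)*(1-e2)*(1+2*c2),
    -32*c2*e2*(1-e2)*(1+2*f2)]

/-- For `0 < γ < e2 < 1`, the point `(γ/(2(e2-γ)), 0)` is an equilibrium of the layer
problem (bue.k23); the Jacobian there is `diag(λ21, λ22)` with
`λ21 = -16 e2 (1-e2)(e2-γ) < 0` and `λ22 = 32 e2² (e2-1)/(e2-γ) < 0`: the critical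
manifold `N2^0` is normally hyperbolic and fully attracting. -/
theorem K2Layer_critical_manifold_attracting (γ e2 : ℝ) (hγ0 : 0 < γ)
    (h1 : γ < e2) (h2 : e2 < 1) :
    K2LayerField γ e2 ![γ/(2*(e2-γ)), 0] = 0 ∧
    HasFDerivAt (K2LayerField γ e2)
      (LinearMap.toContinuousLinearMap
        (Matrix.mulVecLin !![-16*e2*(1-e2)*(e2-γ), 0; 0, 32*e2^2*(e2-1)/(e2-γ)]))
      ![γ/(2*(e2-γ)), 0] ∧
    -16*e2*(1-e2)*(e2-γ) < 0 ∧ 32*e2^2*(e2-1)/(e2-γ) < 0 := by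
  have hd : e2 - γ ≠ 0 := by linarith
  have hp : 0 < e2 - γ := by linarith
  have he : 0 < e2 := by linarith
  have hq : 0 < 1 - e2 := by linarith
  refine ⟨?_, ?_, ?_, ?_⟩
  · ext i
    fin_cases i
    · simp [K2LayerField]
      left; right
      field_simp
      ring
    · simp [K2LayerField]
  · set p : Fin 2 → ℝ := ![γ/(2*(e2-γ)), 0] with hpdef
    have a0 : HasFDerivAt (fun x : Fin 2 → ℝ => x 0)
        (ContinuousLinearMap.proj (R := ℝ) (φ := fun _ : Fin 2 => ℝ) 0) p := hasFDerivAt_apply 0 p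
    have a1 : HasFDerivAt (fun x : Fin 2 → ℝ => x 1)
        (ContinuousLinearMap.proj (R := ℝ) (φ := fun _ : Fin 2 => ℝ) 1) p := hasFDerivAt_apply 1 p
    have b0 := (a0.const_mul 2).const_add 1
    have b1 := (a1.const_mul 2).const_add 1
    have c0 := (((((b0.const_mul γ).sub ((a0.const_mul 2).mul_const e2)).const_mul (8*e2)).mul_const
      (1-e2)).mul b1)
    have c1 := ((((a1.const_mul (-32)).mul_const e2).mul_const (1-e2)).mul b0)
    rw [hasFDerivAt_pi']
    intro i
    fin_cases i
    · refine HasFDerivAt.congr_fderiv (f := fun x => K2LayerField γ e2 x 0) c0 ?_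
      ext v
      simp [hpdef, Matrix.mulVec, dotProduct, Fin.sum_univ_two]
      field_simp
      ring
    · refine HasFDerivAt.congr_fderiv (f := fun x => K2LayerField γ e2 x 1) c1 ?_
      ext v
      simp [hpdef, Matrix.mulVec, dotProduct, Fin.sum_univ_two]
      field_simp
      ring
  · have : 0 < e2 * (1-e2) * (e2-γ) := by positivity
    nlinarith
  · apply div_neg_of_neg_of_pos _ hp
    have : 0 < e2^2 * (1-e2) := by positivity
    nlinarith
end

section
/- Fix γ and e3 with 0 < γ < e3 < 1 and set ε3* = 2·(e3−γ)/γ. The point (c3, ε3) = (0, ε3*) is an equilibrium of the planar system (bue.k34), and the derivative (Jacobian matrix) of the planar vector field at this point is the diagonal matrix diag(μ1, μ2) with μ1 = −32·e3·(1−e3)·(ε3*+2) and μ2 = −8·γ·e3·(1−e3)·(ε3*)². Both μ1 < 0 and μ2 < 0; hence the curve N3^0 is fully attracting for the flow in the invariant plane {r3 = 0}. -/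
/-- The planar vector field of system (bue.k34), the restriction of the blown-up
chart-K3 system to the invariant plane `{r3 = 0}` for fixed `e3`, in coordinates
`x = (c3, ε3)`. -/
noncomputable def K34Field (γ e3 : ℝ) (x : Fin 2 → ℝ) : Fin 2 → ℝ :=
  let c3 := x 0
  let ε3 := x 1
  ![-8*c3*e3*(1-e3)*((γ*(ε3+2) - 2*e3)*(ε3+2*c3) + 4*(ε3+2)),
    -8*ε3*e3*(1-e3)*(γ*(ε3+2) - 2*e3)*(ε3+2*c3)]

/-- For `0 < γ < e3 < 1` and `ε3* = 2(e3-γ)/γ`, the point `(0, ε3*)` is an equilibrium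
of (bue.k34); the Jacobian there is `diag(μ1, μ2)` with
`μ1 = -32 e3 (1-e3)(ε3*+2) < 0` and `μ2 = -8 γ e3 (1-e3)(ε3*)² < 0`: the curve
`N3^0` is fully attracting for the flow in the invariant plane `{r3 = 0}`. -/
theorem K34Field_N30_attracting (γ e3 : ℝ) (hγ0 : 0 < γ) (h1 : γ < e3) (h2 : e3 < 1) :
    K34Field γ e3 ![0, 2*(e3-γ)/γ] = 0 ∧
    HasFDerivAt (K34Field γ e3)
      (LinearMap.toContinuousLinearMap
        (Matrix.mulVecLin
          !![-32*e3*(1-e3)*(2*(e3-γ)/γ + 2), 0;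
             0, -8*γ*e3*(1-e3)*(2*(e3-γ)/γ)^2])) ![0, 2*(e3-γ)/γ] ∧
    -32*e3*(1-e3)*(2*(e3-γ)/γ + 2) < 0 ∧
    -8*γ*e3*(1-e3)*(2*(e3-γ)/γ)^2 < 0 := by
  have he : 0 < e3 := hγ0.trans h1
  have h3 : 0 < 1 - e3 := by linarith
  have hE : 0 < 2*(e3-γ)/γ := by
    have : 0 < e3 - γ := by linarith
    positivity
  have hz : γ*(2*(e3-γ)/γ+2) - 2*e3 = 0 := by
    field_simp
    ring
  generalize 2*(e3-γ)/γ = E at hE hz ⊢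
  refine ⟨?_, ?_, ?_, ?_⟩
  · funext i
    fin_cases i
    · simp [K34Field]
    · simp [K34Field, hz]
  · have d0 : HasFDerivAt (fun x : Fin 2 → ℝ => x 0)
        (ContinuousLinearMap.proj (R := ℝ) (φ := fun _ : Fin 2 => ℝ) 0) ![0, E] :=
      hasFDerivAt_apply 0 _
    have d1 : HasFDerivAt (fun x : Fin 2 → ℝ => x 1)
        (ContinuousLinearMap.proj (R := ℝ) (φ := fun _ : Fin 2 => ℝ) 1) ![0, E] :=
      hasFDerivAt_apply 1 _
    have dA := ((d1.add_const 2).const_mul γ).sub_const (2*e3)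
    have dB := d1.add (d0.const_mul 2)
    have dC := (d1.add_const 2).const_mul 4
    have f0 := (((d0.const_mul (-8)).mul_const e3).mul_const (1-e3)).mul ((dA.mul dB).add dC)
    have f1 := ((((d1.const_mul (-8)).mul_const e3).mul_const (1-e3)).mul dA).mul dB
    rw [hasFDerivAt_pi']
    intro i
    fin_cases i
    · refine HasFDerivAt.congr_fderiv f0 ?_
      ext v
      simp [Matrix.mulVec, dotProduct, Fin.sum_univ_two, hz]
      ring
    · refine HasFDerivAt.congr_fderiv f1 ?_
      ext v
      simp [Matrix.mulVec, dotProduct, Fin.sum_univ_two, hz]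
      ring
  · have : 0 < 32*e3*(1-e3)*(E+2) := by positivity
    linarith
  · have : 0 < 8*γ*e3*(1-e3)*E^2 := by positivity
    linarith
end

section
/- For all r3, e3 ∈ ℝ, the point (r3, 0, e3) is an equilibrium of system (bue.k33), and the Jacobian matrix of the vector field of (bue.k33) at (r3, 0, e3) has characteristic polynomial X²·(X − λ) with λ = 64·e3·(1−e3)·(1−r3)·(2·r3 − 1); i.e., its eigenvalues are 0 (with multiplicity two) and λ. In particular, for 0 < e3 < 1 the nonzero eigenvalue satisfies λ < 0 when 0 ≤ r3 < 1/2 and λ > 0 when 1/2 < r3 < 1; hence the plane of equilibria {c3 = 0} changes stability exactly at r3 = 1/2. -/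
open Polynomial

/-- The vector field of system (bue.k33), the restriction of the blown-up chart-K3
system to the invariant plane `{ε3 = 0}`, in coordinates `x = (r3, c3, e3)`. -/
noncomputable def K33Field (γ : ℝ) (x : Fin 3 → ℝ) : Fin 3 → ℝ :=
  let r3 := x 0
  let c3 := x 1
  let e3 := x 2
  let V := 32*e3*(1-r3)*(1-e3)*(1-r3*c3)
  ![r3*c3*(γ-e3)*V,
    c3*((4*r3-2) - c3*(γ-e3))*V,
    2*r3*c3*(2*r3*c3-1)*V]

theorem K33_aux (f g : (Fin 3 → ℝ) → ℝ) (p : Fin 3 → ℝ) (L : (Fin 3 → ℝ) →L[ℝ] ℝ)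
    (hp : p 1 = 0) (hg : DifferentiableAt ℝ g p) (hf : ∀ x, f x = x 1 * g x)
    (hL : ∀ v, L v = g p * v 1) : HasFDerivAt f L p := by
  have h1 : HasFDerivAt (fun x : Fin 3 → ℝ => x 1)
      (ContinuousLinearMap.proj 1 : (Fin 3 → ℝ) →L[ℝ] ℝ) p := hasFDerivAt_apply 1 p
  have h := h1.mul hg.hasFDerivAt
  rw [hp, zero_smul, zero_add] at h
  have e1 : f = (fun x : Fin 3 → ℝ => x 1) * g := funext hf
  have e2 : L = g p • (ContinuousLinearMap.proj 1 : (Fin 3 → ℝ) →L[ℝ] ℝ) :=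
    ContinuousLinearMap.ext fun v => by rw [hL]; rfl
  rw [e1, e2]
  exact h

/-- Every point `(r3, 0, e3)` is an equilibrium of (bue.k33); the Jacobian there has
characteristic polynomial `X²·(X − λ)` with `λ = 64 e3 (1-e3)(1-r3)(2 r3 - 1)`, whose
sign (for `0 < e3 < 1`) changes exactly at `r3 = 1/2`. -/
theorem K33Field_plane_equilibria (γ : ℝ) (hγ0 : 0 < γ) (hγ1 : γ < 1) (r3 e3 : ℝ) :
    K33Field γ ![r3, 0, e3] = 0 ∧
    (∃ A : Matrix (Fin 3) (Fin 3) ℝ,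
      HasFDerivAt (K33Field γ) (LinearMap.toContinuousLinearMap A.mulVecLin) ![r3, 0, e3] ∧
      A.charpoly = X^2 * (X - C (64*e3*(1-e3)*(1-r3)*(2*r3 - 1)))) ∧
    (0 < e3 → e3 < 1 → 0 ≤ r3 → r3 < 1/2 → 64*e3*(1-e3)*(1-r3)*(2*r3 - 1) < 0) ∧
    (0 < e3 → e3 < 1 → 1/2 < r3 → r3 < 1 → 0 < 64*e3*(1-e3)*(1-r3)*(2*r3 - 1)) := by
  refine ⟨?_, ?_, ?_, ?_⟩
  · ext i
    fin_cases i <;> simp [K33Field]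
  · let W : ℝ := 32*e3*(1-r3)*(1-e3)
    refine ⟨!![0, r3*(γ-e3)*W, 0; 0, (4*r3-2)*W, 0; 0, -(2*r3)*W, 0], ?_, ?_⟩
    · rw [hasFDerivAt_pi']
      intro i
      fin_cases i
      · refine K33_aux _ (fun x => x 0*(γ-x 2)*(32*x 2*(1-x 0)*(1-x 2)*(1-x 0*x 1)))
          _ _ (by simp) (by fun_prop) ?_ ?_
        · intro x; simp [K33Field]; ring
        · intro v; simp [Matrix.mulVec, dotProduct, Fin.sum_univ_three, W]
      · refine K33_aux _ (fun x => ((4*x 0-2) - x 1*(γ-x 2))*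
            (32*x 2*(1-x 0)*(1-x 2)*(1-x 0*x 1)))
          _ _ (by simp) (by fun_prop) ?_ ?_
        · intro x; simp [K33Field]; ring
        · intro v; simp [Matrix.mulVec, dotProduct, Fin.sum_univ_three, W]
      · refine K33_aux _ (fun x => 2*x 0*(2*x 0*x 1-1)*
            (32*x 2*(1-x 0)*(1-x 2)*(1-x 0*x 1)))
          _ _ (by simp) (by fun_prop) ?_ ?_
        · intro x; simp [K33Field]; ring
        · intro v; simp [Matrix.mulVec, dotProduct, Fin.sum_univ_three, W]
    · have hW : 64*e3*(1-e3)*(1-r3)*(2*r3 - 1) = (4*r3-2)*W := by simp only [W]; ring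
      rw [hW, Matrix.charpoly, Matrix.det_fin_three]
      simp [Matrix.charmatrix_apply, -map_mul, -map_sub]
      ring
  · intro h0 h1 h2 h3
    have : 0 < 64*e3*(1-e3)*(1-r3) := by
      have := sub_pos.2 h1
      have : 0 < 1 - r3 := by linarith
      positivity
    exact mul_neg_of_pos_of_neg this (by linarith)
  · intro h0 h1 h2 h3
    have : 0 < 64*e3*(1-e3)*(1-r3) := by
      have := sub_pos.2 h1
      have : 0 < 1 - r3 := by linarith
      positivity
    exact mul_pos this (by linarith)
end

section
/- Let h : ℝ → ℝ be any continuously differentiable function with h(0) = 1. For every e3 ∈ ℝ, the point (r3, e3, ε3) = (0, e3, 0) is an equilibrium of the reduced center-manifold system (center.manifold31), and the derivative of its vector field at this point, with respect to the coordinates (r3, e3, ε3), equals the matrix [[8·e3·(e3−1)·(e3−γ), 0, 0], [16·e3·(e3−1), 0, 0], [0, 0, −8·e3·(e3−1)·(e3−γ)]]. In particular, its eigenvalues are 8·e3·(e3−1)·(e3−γ), 0, and −8·e3·(e3−1)·(e3−γ). -/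
/-- The vector field of the reduced center-manifold system (center.manifold31) in
chart K3, in coordinates `x = (r3, e3, ε3)`, where `h` is the C¹ function with
`h 0 = 1` representing the factor `1 + O(r3 ε3)` in the center-manifold graph. -/
noncomputable def CM31Field (γ : ℝ) (h : ℝ → ℝ) (x : Fin 3 → ℝ) : Fin 3 → ℝ :=
  let r3 := x 0
  let e3 := x 1
  let ε3 := x 2
  let G34 := (γ*(1-r3)*(ε3+2) - 2*e3*(r3*ε3+1-r3)) * (r3*ε3+2-2*e3) * (r3*ε3+2*e3)
  let G35 := (8*r3^2*ε3*h (r3*ε3)*(1-e3)*(r3*ε3+2*e3) - 4*e3*(r3*ε3+2-2*e3))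
    * (r3*ε3+1-r3) * (ε3+2)
  ![r3*G34, r3*G35, -ε3*G34]

/-- Every point `(0, e3, 0)` is an equilibrium of (center.manifold31), and the
Jacobian there (in coordinates `(r3, e3, ε3)`) equals
`[[8 e3 (e3-1)(e3-γ), 0, 0], [16 e3 (e3-1), 0, 0], [0, 0, -8 e3 (e3-1)(e3-γ)]]`,
whose eigenvalues are `8 e3 (e3-1)(e3-γ)`, `0`, and `-8 e3 (e3-1)(e3-γ)`. -/
theorem CM31Field_line_linearization (γ : ℝ) (hγ0 : 0 < γ) (hγ1 : γ < 1)
    (h : ℝ → ℝ) (hh : ContDiff ℝ 1 h) (hh0 : h 0 = 1) (e3 : ℝ) :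
    CM31Field γ h ![0, e3, 0] = 0 ∧
    HasFDerivAt (CM31Field γ h)
      (LinearMap.toContinuousLinearMap
        (Matrix.mulVecLin
          !![8*e3*(e3-1)*(e3-γ), 0, 0;
             16*e3*(e3-1), 0, 0;
             0, 0, -(8*e3*(e3-1)*(e3-γ))])) ![0, e3, 0] := by
  have hd : Differentiable ℝ h := hh.differentiable (by norm_num)
  have h0 : HasFDerivAt (fun x : Fin 3 → ℝ => x 0)
      (ContinuousLinearMap.proj (R := ℝ) (φ := fun _ : Fin 3 => ℝ) 0) ![0, e3, 0] :=
    (ContinuousLinearMap.proj (R := ℝ) (φ := fun _ : Fin 3 => ℝ) 0).hasFDerivAt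
  have h2 : HasFDerivAt (fun x : Fin 3 → ℝ => x 2)
      (ContinuousLinearMap.proj (R := ℝ) (φ := fun _ : Fin 3 => ℝ) 2) ![0, e3, 0] :=
    (ContinuousLinearMap.proj (R := ℝ) (φ := fun _ : Fin 3 => ℝ) 2).hasFDerivAt
  have hA : DifferentiableAt ℝ (fun x : Fin 3 → ℝ =>
      (γ*(1-x 0)*(x 2+2) - 2*x 1*(x 0*x 2+1-x 0)) * (x 0*x 2+2-2*x 1) * (x 0*x 2+2*x 1))
      ![0, e3, 0] := by fun_prop
  have hB : DifferentiableAt ℝ (fun x : Fin 3 → ℝ =>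
      (8*x 0^2*x 2*h (x 0*x 2)*(1-x 1)*(x 0*x 2+2*x 1) - 4*x 1*(x 0*x 2+2-2*x 1))
        * (x 0*x 2+1-x 0) * (x 2+2)) ![0, e3, 0] := by fun_prop
  refine ⟨?_, ?_⟩
  · ext i
    fin_cases i <;> simp [CM31Field]
  · rw [hasFDerivAt_pi']
    intro i
    fin_cases i
    · refine (h0.mul hA.hasFDerivAt).congr_fderiv ?_
      ext v
      simp [Matrix.mulVec, dotProduct, Fin.sum_univ_three]
      left
      ring
    · refine (h0.mul hB.hasFDerivAt).congr_fderiv ?_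
      ext v
      simp [Matrix.mulVec, dotProduct, Fin.sum_univ_three]
      ring
    · refine (h2.neg.mul hA.hasFDerivAt).congr_fderiv ?_
      ext v
      simp [Matrix.mulVec, dotProduct, Fin.sum_univ_three]
      left
      ring
end

section
/- Let h : ℝ → ℝ be any continuously differentiable function with h(0) = 1 and let 0 < γ < 1. The exit point q_{e3} = (r3, e3, ε3) = (0, γ, 0) is an equilibrium of the reduced center-manifold system (center.manifold31), and the derivative M of its vector field at q_{e3} satisfies M ≠ 0 and M² = 0; i.e., the linearization at q_{e3} is a nonzero nilpotent matrix (all of its eigenvalues vanish), so q_{e3} is a nilpotent (fully degenerate) equilibrium. -/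
/-- The exit point `q_{e3} = (0, γ, 0)` is an equilibrium of (center.manifold31),
and its linearization `M` is a nonzero nilpotent map (`M ≠ 0`, `M² = 0`): `q_{e3}`
is a nilpotent (fully degenerate) equilibrium. -/
theorem CM31Field_exit_point_nilpotent (γ : ℝ) (hγ0 : 0 < γ) (hγ1 : γ < 1)
    (h : ℝ → ℝ) (hh : ContDiff ℝ 1 h) (hh0 : h 0 = 1) :
    CM31Field γ h ![0, γ, 0] = 0 ∧
    ∃ M : (Fin 3 → ℝ) →L[ℝ] (Fin 3 → ℝ),
      HasFDerivAt (CM31Field γ h) M ![0, γ, 0] ∧ M ≠ 0 ∧ M.comp M = 0 := by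
  have hd : Differentiable ℝ h := hh.differentiable (by norm_num)
  refine ⟨?_, ?_⟩
  · funext i
    fin_cases i <;> simp [CM31Field]
  let p : Fin 3 → ℝ := ![0, γ, 0]
  let P : Fin 3 → ((Fin 3 → ℝ) →L[ℝ] ℝ) := fun i => ContinuousLinearMap.proj i
  have hP : ∀ i, HasFDerivAt (fun x : Fin 3 → ℝ => x i) (P i) p := fun i => hasFDerivAt_apply i p
  let c : ℝ := -16*γ*(1-γ)
  have hc : c ≠ 0 := by
    have h1 : 0 < γ * (1-γ) := mul_pos hγ0 (by linarith)
    have h2 : c = -16 * (γ * (1-γ)) := by simp only [c]; ring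
    rw [h2]; exact ne_of_lt (by linarith)
  let G34 : (Fin 3 → ℝ) → ℝ := fun x =>
    (γ*(1-x 0)*(x 2+2) - 2*x 1*(x 0*x 2+1-x 0)) * (x 0*x 2+2-2*x 1) * (x 0*x 2+2*x 1)
  let G35 : (Fin 3 → ℝ) → ℝ := fun x =>
    (8*x 0^2*x 2*h (x 0*x 2)*(1-x 1)*(x 0*x 2+2*x 1) - 4*x 1*(x 0*x 2+2-2*x 1))
      * (x 0*x 2+1-x 0) * (x 2+2)
  have d34 : DifferentiableAt ℝ G34 p := by simp only [G34]; fun_prop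
  have d35 : DifferentiableAt ℝ G35 p := by simp only [G35]; fun_prop
  have e34 : G34 p = 0 := by
    simp only [G34, p, Matrix.cons_val]; ring
  have e35 : G35 p = c := by
    simp only [G35, p, c, Matrix.cons_val]; ring
  have p0 : p 0 = 0 := rfl
  have p2 : p 2 = 0 := rfl
  have k0 := (hP 0).mul d34.hasFDerivAt
  have k1 := (hP 0).mul d35.hasFDerivAt
  have k2 := (hP 2).neg.mul d34.hasFDerivAt
  rw [p0, e34] at k0
  rw [p0, e35] at k1
  rw [Pi.neg_apply, p2, e34] at k2
  refine ⟨ContinuousLinearMap.pi ![0, c • P 0, 0], ?_, ?_, ?_⟩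
  · rw [hasFDerivAt_pi']
    intro i
    fin_cases i
    · refine HasFDerivAt.congr_fderiv (f := fun x => CM31Field γ h x _) k0 ?_
      ext v; simp
    · refine HasFDerivAt.congr_fderiv (f := fun x => CM31Field γ h x _) k1 ?_
      ext v; simp
    · refine HasFDerivAt.congr_fderiv (f := fun x => CM31Field γ h x _) k2 ?_
      ext v; simp
  · intro hM
    have := congrFun (congrArg (fun L => L ![1, 0, 0]) hM) 1
    simp [P] at this
    exact hc this
  · ext v i
    fin_cases i <;> simp [P]
end
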